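/- arXiv:1809.09991 — 4 statements merged into one kernel-verified Lean document; each statement's English description precedes it below -/
import Mathlib

section
/- Let a < b be real numbers and let h : [a,b] → [0,∞) be lower semicontinuous. Then h has finite pointwise variation on [a,b] if and only if the one-dimensional Hausdorff measure of its graph is finite, i.e. Var h < ∞ if and only if H¹(Γ_h) < ∞. -/
open MeasureTheory Topology Filter Set

/-- The subgraph `Ω_h = {(x,y) : a < x < b, y < h x}` of a height function,
realized in the Euclidean plane. -/
def filmSubgraph (a b : ℝ) (h : ℝ → ℝ) : Set (EuclideanSpace ℝ (Fin 2)) :=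
  {p | a < p 0 ∧ p 0 < b ∧ p 1 < h (p 0)}

/-- The vertical strip `(a,b) × ℝ`. -/
def filmStrip (a b : ℝ) : Set (EuclideanSpace ℝ (Fin 2)) :=
  {p | a < p 0 ∧ p 0 < b}

/-- The graph `Γ_h = ∂Ω_h ∩ ((a,b) × ℝ)`. -/
def filmGraph (a b : ℝ) (h : ℝ → ℝ) : Set (EuclideanSpace ℝ (Fin 2)) :=
  frontier (filmSubgraph a b h) ∩ filmStrip a b

theorem isOpen_filmSubgraph {a b : ℝ} {h : ℝ → ℝ}
    (hlsc : LowerSemicontinuousOn h (Icc a b)) : IsOpen (filmSubgraph a b h) := by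
  rw [isOpen_iff_mem_nhds]
  rintro p ⟨hpa, hpb, hp⟩
  obtain ⟨c, hpc, hc⟩ := exists_between hp
  have hl := hlsc (p 0) ⟨hpa.le, hpb.le⟩ c hc
  rw [nhdsWithin_eq_nhds.2 (Icc_mem_nhds hpa hpb)] at hl
  have h0 : Tendsto (fun q : EuclideanSpace ℝ (Fin 2) => q 0) (𝓝 p) (𝓝 (p 0)) :=
    Continuous.tendsto (by fun_prop) p
  have h1 : Tendsto (fun q : EuclideanSpace ℝ (Fin 2) => q 1) (𝓝 p) (𝓝 (p 1)) :=
    Continuous.tendsto (by fun_prop) p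
  filter_upwards [h0.eventually hl, h0.eventually_const_lt hpa, h0.eventually_lt_const hpb,
    h1.eventually_lt_const hpc] with q hq hqa hqb hqc
  exact ⟨hqa, hqb, hqc.trans hq⟩

theorem EuclideanSpace.dist_le_abs_add_abs (p q : EuclideanSpace ℝ (Fin 2)) :
    dist p q ≤ |p 0 - q 0| + |p 1 - q 1| := by
  rw [EuclideanSpace.dist_eq, Fin.sum_univ_two, Real.dist_eq, Real.dist_eq]
  apply Real.sqrt_le_iff.2
  constructor
  · positivity
  · nlinarith [abs_nonneg (p 0 - q 0), abs_nonneg (p 1 - q 1)]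

theorem EuclideanSpace.abs_apply_sub_le_dist (p q : EuclideanSpace ℝ (Fin 2)) (i : Fin 2) :
    |p i - q i| ≤ dist p q := by
  simpa [dist_eq_norm] using PiLp.norm_apply_le (p - q) i

/-- A subset of a metric space which some real function maps expandingly onto a bounded set has
finite one-dimensional Hausdorff measure. -/
theorem hausdorffMeasure_one_lt_top_of_expanding {X : Type*} [MetricSpace X] [MeasurableSpace X]
    [BorelSpace X] {S : Set X} {σ : X → ℝ} {A B : ℝ}
    (hσ : ∀ p ∈ S, ∀ q ∈ S, dist p q ≤ |σ p - σ q|) (hS : ∀ p ∈ S, σ p ∈ Icc A B) :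
    μH[1] S < ⊤ := by
  rcases S.eq_empty_or_nonempty with rfl | ⟨p₀, hp₀⟩
  · simp
  have : Nonempty X := ⟨p₀⟩
  have hinv : ∀ p ∈ S, Function.invFunOn σ S (σ p) = p := by
    intro p hp
    have hex : ∃ q ∈ S, σ q = σ p := ⟨p, hp, rfl⟩
    have hd := hσ _ (Function.invFunOn_mem hex) p hp
    rw [Function.invFunOn_eq hex, sub_self, abs_zero] at hd
    exact dist_le_zero.1 hd
  have hlip : LipschitzOnWith 1 (Function.invFunOn σ S) (σ '' S) := by
    apply LipschitzOnWith.of_dist_le_mul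
    rintro _ ⟨p, hp, rfl⟩ _ ⟨q, hq, rfl⟩
    rw [hinv p hp, hinv q hq, Real.dist_eq]
    simpa using hσ p hp q hq
  have himg : S ⊆ Function.invFunOn σ S '' (σ '' S) :=
    fun p hp => ⟨σ p, ⟨p, hp, rfl⟩, hinv p hp⟩
  calc μH[1] S ≤ μH[1] (Function.invFunOn σ S '' (σ '' S)) := measure_mono himg
    _ ≤ μH[1] (σ '' S) := by
      simpa using hlip.hausdorffMeasure_image_le zero_le_one
    _ ≤ μH[1] (Icc A B) := measure_mono (by rintro _ ⟨p, hp, rfl⟩; exact hS p hp)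
    _ < ⊤ := by rw [hausdorffMeasure_real]; exact measure_Icc_lt_top

/-- The points of the strip on or above the graph of `h` that can be approximated from the left by
points below the graph. -/
def leftFilmGraph (a b : ℝ) (h : ℝ → ℝ) : Set (EuclideanSpace ℝ (Fin 2)) :=
  {p | p ∈ filmStrip a b ∧ h (p 0) ≤ p 1 ∧
    ∀ ε > 0, ∀ x < p 0, ∃ z ∈ Ioc x (p 0), p 1 - ε < h z}

/-- The points of the strip on or above the graph of `h` that can be approximated from the right by
points below the graph. -/
def rightFilmGraph (a b : ℝ) (h : ℝ → ℝ) : Set (EuclideanSpace ℝ (Fin 2)) :=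
  {p | p ∈ filmStrip a b ∧ h (p 0) ≤ p 1 ∧
    ∀ ε > 0, ∀ x > p 0, ∃ z ∈ Ico (p 0) x, p 1 - ε < h z}

theorem filmGraph_subset {a b : ℝ} {h : ℝ → ℝ} (hlsc : LowerSemicontinuousOn h (Icc a b)) :
    filmGraph a b h ⊆ leftFilmGraph a b h ∪ rightFilmGraph a b h := by
  rintro p ⟨hp, hps⟩
  rw [(isOpen_filmSubgraph hlsc).frontier_eq] at hp
  have hle : h (p 0) ≤ p 1 := not_lt.1 fun hlt => hp.2 ⟨hps.1, hps.2, hlt⟩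
  by_contra hcon
  rw [mem_union, not_or] at hcon
  obtain ⟨hl, hr⟩ := hcon
  have hl' : ¬ ∀ ε > 0, ∀ x < p 0, ∃ z ∈ Ioc x (p 0), p 1 - ε < h z :=
    fun H => hl ⟨hps, hle, H⟩
  have hr' : ¬ ∀ ε > 0, ∀ x > p 0, ∃ z ∈ Ico (p 0) x, p 1 - ε < h z :=
    fun H => hr ⟨hps, hle, H⟩
  push Not at hl' hr'
  obtain ⟨ε₁, hε₁, x₁, hx₁, H₁⟩ := hl'
  obtain ⟨ε₂, hε₂, x₂, hx₂, H₂⟩ := hr'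
  have hδ : 0 < min (min ε₁ ε₂) (min (p 0 - x₁) (x₂ - p 0)) := by
    simp only [lt_min_iff, sub_pos]
    exact ⟨⟨hε₁, hε₂⟩, hx₁, hx₂⟩
  obtain ⟨q, hq, hpq⟩ := Metric.mem_closure_iff.1 hp.1 _ hδ
  simp only [lt_min_iff] at hpq
  have h0 := abs_le.1 (EuclideanSpace.abs_apply_sub_le_dist p q 0)
  have h1 := abs_le.1 (EuclideanSpace.abs_apply_sub_le_dist p q 1)
  have hq1 := hq.2.2
  rcases le_total (q 0) (p 0) with hqp | hqp
  · have := H₁ (q 0) ⟨by linarith, hqp⟩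
    linarith
  · have := H₂ (q 0) ⟨hqp, by linarith⟩
    linarith

theorem hausdorffMeasure_leftFilmGraph_lt_top {a b : ℝ} {h V : ℝ → ℝ} {C : ℝ}
    (hV : ∀ x ∈ Icc a b, ∀ y ∈ Icc a b, x ≤ y → |h y - h x| ≤ V y - V x)
    (hC : ∀ x ∈ Icc a b, |h x| ≤ C ∧ |V x| ≤ C) :
    μH[1] (leftFilmGraph a b h) < ⊤ := by
  have key : ∀ p ∈ leftFilmGraph a b h, ∀ q ∈ leftFilmGraph a b h, p 0 ≤ q 0 →
      |p 0 - q 0| + |p 1 - q 1| ≤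
        |(p 0 + V (p 0) - (p 1 - h (p 0))) - (q 0 + V (q 0) - (q 1 - h (q 0)))| := by
    rintro p ⟨⟨hpa, hpb⟩, hpy, -⟩ q ⟨⟨hqa, hqb⟩, hqy, hq⟩ hpq
    rcases hpq.eq_or_lt with heq | hlt
    · rw [heq, sub_self, abs_zero, zero_add]
      apply le_of_eq
      rw [abs_sub_comm]
      congr 1
      ring
    · apply le_of_forall_pos_le_add
      intro ε hε
      obtain ⟨z, ⟨hpz, hzq⟩, hz⟩ := hq (ε / 2) (by positivity) (p 0) hlt
      have hzI : z ∈ Icc a b := ⟨by linarith, by linarith⟩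
      have h1 := abs_le.1 (hV (p 0) ⟨hpa.le, hpb.le⟩ z hzI hpz.le)
      have h2 := abs_le.1 (hV z hzI (q 0) ⟨hqa.le, hqb.le⟩ hzq)
      have h3 := neg_abs_le
        ((p 0 + V (p 0) - (p 1 - h (p 0))) - (q 0 + V (q 0) - (q 1 - h (q 0))))
      rw [abs_of_neg (sub_neg.2 hlt)]
      rcases abs_cases (p 1 - q 1) with ⟨h4, -⟩ | ⟨h4, -⟩ <;> rw [h4] <;> linarith
  refine hausdorffMeasure_one_lt_top_of_expanding (A := a - 4 * C) (B := b + 4 * C)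
    (σ := fun p => p 0 + V (p 0) - (p 1 - h (p 0))) ?_ ?_
  · intro p hp q hq
    refine (EuclideanSpace.dist_le_abs_add_abs p q).trans ?_
    rcases le_total (p 0) (q 0) with hpq | hpq
    · exact key p hp q hq hpq
    · rw [abs_sub_comm (p 0), abs_sub_comm (p 1), abs_sub_comm (p 0 + V (p 0) - _)]
      exact key q hq p hp hpq
  · rintro p ⟨⟨hpa, hpb⟩, hpy, hp⟩
    have h1 := hC (p 0) ⟨hpa.le, hpb.le⟩
    have hle : p 1 ≤ C := by
      apply le_of_forall_pos_le_add
      intro ε hε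
      obtain ⟨z, ⟨hpz, hzq⟩, hz⟩ := hp ε hε a hpa
      have := abs_le.1 (hC z ⟨by linarith, by linarith⟩).1
      linarith
    have h2 := abs_le.1 h1.1
    have h3 := abs_le.1 h1.2
    constructor <;> dsimp only <;> linarith

theorem hausdorffMeasure_rightFilmGraph_lt_top {a b : ℝ} {h V : ℝ → ℝ} {C : ℝ}
    (hV : ∀ x ∈ Icc a b, ∀ y ∈ Icc a b, x ≤ y → |h y - h x| ≤ V y - V x)
    (hC : ∀ x ∈ Icc a b, |h x| ≤ C ∧ |V x| ≤ C) :
    μH[1] (rightFilmGraph a b h) < ⊤ := by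
  have key : ∀ p ∈ rightFilmGraph a b h, ∀ q ∈ rightFilmGraph a b h, p 0 ≤ q 0 →
      |p 0 - q 0| + |p 1 - q 1| ≤
        |(p 0 + V (p 0) + (p 1 - h (p 0))) - (q 0 + V (q 0) + (q 1 - h (q 0)))| := by
    rintro p ⟨⟨hpa, hpb⟩, hpy, hp⟩ q ⟨⟨hqa, hqb⟩, hqy, -⟩ hpq
    rcases hpq.eq_or_lt with heq | hlt
    · rw [heq, sub_self, abs_zero, zero_add]
      apply le_of_eq
      congr 1
      ring
    · apply le_of_forall_pos_le_add
      intro ε hε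
      obtain ⟨z, ⟨hpz, hzq⟩, hz⟩ := hp (ε / 2) (by positivity) (q 0) hlt
      have hzI : z ∈ Icc a b := ⟨by linarith, by linarith⟩
      have h1 := abs_le.1 (hV (p 0) ⟨hpa.le, hpb.le⟩ z hzI hpz)
      have h2 := abs_le.1 (hV z hzI (q 0) ⟨hqa.le, hqb.le⟩ hzq.le)
      have h3 := neg_abs_le
        ((p 0 + V (p 0) + (p 1 - h (p 0))) - (q 0 + V (q 0) + (q 1 - h (q 0))))
      rw [abs_of_neg (sub_neg.2 hlt)]
      rcases abs_cases (p 1 - q 1) with ⟨h4, -⟩ | ⟨h4, -⟩ <;> rw [h4] <;> linarith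
  refine hausdorffMeasure_one_lt_top_of_expanding (A := a - 4 * C) (B := b + 4 * C)
    (σ := fun p => p 0 + V (p 0) + (p 1 - h (p 0))) ?_ ?_
  · intro p hp q hq
    refine (EuclideanSpace.dist_le_abs_add_abs p q).trans ?_
    rcases le_total (p 0) (q 0) with hpq | hpq
    · exact key p hp q hq hpq
    · rw [abs_sub_comm (p 0), abs_sub_comm (p 1), abs_sub_comm (p 0 + V (p 0) + _)]
      exact key q hq p hp hpq
  · rintro p ⟨⟨hpa, hpb⟩, hpy, hp⟩
    have h1 := hC (p 0) ⟨hpa.le, hpb.le⟩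
    have hle : p 1 ≤ C := by
      apply le_of_forall_pos_le_add
      intro ε hε
      obtain ⟨z, ⟨hpz, hzq⟩, hz⟩ := hp ε hε b hpb
      have := abs_le.1 (hC z ⟨by linarith, by linarith⟩).1
      linarith
    have h2 := abs_le.1 h1.1
    have h3 := abs_le.1 h1.2
    constructor <;> dsimp only <;> linarith

theorem hausdorffMeasure_filmGraph_lt_top {a b : ℝ} (hab : a < b) {h : ℝ → ℝ}
    (hlsc : LowerSemicontinuousOn h (Icc a b)) (hbv : BoundedVariationOn h (Icc a b)) :
    μH[1] (filmGraph a b h) < ⊤ := by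
  have haI : a ∈ Icc a b := left_mem_Icc.2 hab.le
  have hV : ∀ x ∈ Icc a b, ∀ y ∈ Icc a b, x ≤ y → |h y - h x| ≤
      variationOnFromTo h (Icc a b) a y - variationOnFromTo h (Icc a b) a x :=
    fun x hx y hy hxy => variationOnFromTo.abs_sub_le_sub_of_le
      hbv.locallyBoundedVariationOn haI hx hy hxy
  have hC : ∀ x ∈ Icc a b, |h x| ≤ |h a| + (eVariationOn h (Icc a b)).toReal ∧
      |variationOnFromTo h (Icc a b) a x| ≤ |h a| + (eVariationOn h (Icc a b)).toReal := by
    intro x hx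
    constructor
    · have h1 := hbv.dist_le hx haI
      rw [Real.dist_eq] at h1
      linarith [abs_sub_abs_le_abs_sub (h x) (h a)]
    · linarith [variationOnFromTo.abs_le_eVariationOn hbv (a := a) (b := x),
        abs_nonneg (h a)]
  calc μH[1] (filmGraph a b h) ≤ μH[1] (leftFilmGraph a b h ∪ rightFilmGraph a b h) :=
        measure_mono (filmGraph_subset hlsc)
    _ ≤ μH[1] (leftFilmGraph a b h) + μH[1] (rightFilmGraph a b h) := measure_union_le _ _
    _ < ⊤ := ENNReal.add_lt_top.2 ⟨hausdorffMeasure_leftFilmGraph_lt_top hV hC,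
        hausdorffMeasure_rightFilmGraph_lt_top hV hC⟩

theorem mem_filmGraph_of_frequently {a b : ℝ} {h : ℝ → ℝ}
    (hlsc : LowerSemicontinuousOn h (Icc a b)) {x y : ℝ} (hx : x ∈ Ioo a b) (hxy : h x ≤ y)
    (hf : ∃ᶠ z in 𝓝 x, y < h z) : !₂[x, y] ∈ filmGraph a b h := by
  refine ⟨?_, hx.1, hx.2⟩
  rw [(isOpen_filmSubgraph hlsc).frontier_eq]
  refine ⟨?_, fun hm => absurd hm.2.2 (by simpa using hxy)⟩
  have ht : Tendsto (fun z : ℝ => !₂[z, y]) (𝓝 x) (𝓝 !₂[x, y]) :=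
    Continuous.tendsto (by fun_prop) x
  refine mem_closure_of_frequently_of_tendsto ?_ ht
  refine (hf.and_eventually (Ioo_mem_nhds hx.1 hx.2)).mono ?_
  rintro z ⟨hz, hza, hzb⟩
  exact ⟨hza, hzb, hz⟩

/-- Between two points of `(a, b)`, the graph crosses every height strictly between the two
values. -/
theorem exists_mem_filmGraph {a b : ℝ} {h : ℝ → ℝ}
    (hlsc : LowerSemicontinuousOn h (Icc a b)) {c d y : ℝ} (hc : c ∈ Ioo a b) (hd : d ∈ Ioo a b)
    (hcd : c ≤ d) (hy : y ∈ Ioo (min (h c) (h d)) (max (h c) (h d))) :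
    ∃ x ∈ Icc c d, !₂[x, y] ∈ filmGraph a b h := by
  have hsub : Icc c d ⊆ Ioo a b := fun x hx => ⟨hc.1.trans_le hx.1, hx.2.trans_lt hd.2⟩
  by_contra! hcon
  have hopen : ∀ x ∈ Icc c d, y < h x → ∀ᶠ z in 𝓝 x, y < h z := by
    intro x hx hyx
    have hl := hlsc x (Ioo_subset_Icc_self (hsub hx)) y hyx
    rwa [nhdsWithin_eq_nhds.2 (Icc_mem_nhds (hsub hx).1 (hsub hx).2)] at hl
  have hopen' : ∀ x ∈ Icc c d, h x ≤ y → ∀ᶠ z in 𝓝 x, h z ≤ y := by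
    intro x hx hyx
    have := fun hf => hcon x hx (mem_filmGraph_of_frequently hlsc (hsub hx) hyx hf)
    exact (not_frequently.1 this).mono fun z hz => not_lt.1 hz
  have hconn : IsPreconnected (Icc c d) := isPreconnected_Icc
  have hu : IsOpen {x | ∀ᶠ z in 𝓝 x, y < h z} := isOpen_setOfPred_eventually_nhds
  have hv : IsOpen {x | ∀ᶠ z in 𝓝 x, h z ≤ y} := isOpen_setOfPred_eventually_nhds
  have hcover : ∀ x ∈ Icc c d,
      x ∈ {x | ∀ᶠ z in 𝓝 x, y < h z} ∨ x ∈ {x | ∀ᶠ z in 𝓝 x, h z ≤ y} := by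
    intro x hx
    rcases lt_or_ge y (h x) with hyx | hyx
    · exact Or.inl (hopen x hx hyx)
    · exact Or.inr (hopen' x hx hyx)
  have hcm : c ∈ Icc c d := left_mem_Icc.2 hcd
  have hdm : d ∈ Icc c d := right_mem_Icc.2 hcd
  have hne : (Icc c d ∩ {x | ∀ᶠ z in 𝓝 x, y < h z}).Nonempty ∧
      (Icc c d ∩ {x | ∀ᶠ z in 𝓝 x, h z ≤ y}).Nonempty := by
    obtain ⟨hy1, hy2⟩ := hy
    rcases lt_max_iff.1 hy2 with h1 | h1 <;> rcases min_lt_iff.1 hy1 with h2 | h2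
    · exact absurd h1 h2.not_gt
    · exact ⟨⟨c, hcm, hopen c hcm h1⟩, ⟨d, hdm, hopen' d hdm h2.le⟩⟩
    · exact ⟨⟨d, hdm, hopen d hdm h1⟩, ⟨c, hcm, hopen' c hcm h2.le⟩⟩
    · exact absurd h1 h2.not_gt
  obtain ⟨x, -, hxu, hxv⟩ := hconn _ _ hu hv (fun x hx => hcover x hx) hne.1 hne.2
  exact absurd hxu.self_of_nhds (not_lt.2 hxv.self_of_nhds)

theorem ofReal_abs_sub_le_hausdorffMeasure {a b : ℝ} {h : ℝ → ℝ}
    (hlsc : LowerSemicontinuousOn h (Icc a b)) {c d : ℝ} (hc : c ∈ Ioo a b) (hd : d ∈ Ioo a b)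
    (hcd : c ≤ d) :
    ENNReal.ofReal |h d - h c| ≤ μH[1] (filmGraph a b h ∩ {p | p 0 ∈ Icc c d}) := by
  have hlip : LipschitzWith 1 (fun p : EuclideanSpace ℝ (Fin 2) => p 1) := by
    apply LipschitzWith.of_dist_le_mul
    intro p q
    simpa [Real.dist_eq] using EuclideanSpace.abs_apply_sub_le_dist p q 1
  calc ENNReal.ofReal |h d - h c|
      = μH[1] (Ioo (min (h c) (h d)) (max (h c) (h d))) := by
        rw [hausdorffMeasure_real, Real.volume_Ioo, max_sub_min_eq_abs]
    _ ≤ μH[1] ((fun p : EuclideanSpace ℝ (Fin 2) => p 1) ''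
          (filmGraph a b h ∩ {p | p 0 ∈ Icc c d})) := by
        apply measure_mono
        intro y hy
        obtain ⟨x, hx, hxy⟩ := exists_mem_filmGraph hlsc hc hd hcd hy
        exact ⟨!₂[x, y], ⟨hxy, hx⟩, rfl⟩
    _ ≤ _ := by simpa using hlip.hausdorffMeasure_image_le zero_le_one _

theorem boundedVariationOn_of_abs_sub_le {s : Set ℝ} {f g : ℝ → ℝ} {A B : ℝ}
    (hfg : ∀ x ∈ s, ∀ y ∈ s, x ≤ y → |f y - f x| ≤ g y - g x)
    (hg : ∀ x ∈ s, g x ∈ Icc A B) : BoundedVariationOn f s := by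
  refine ne_top_of_le_ne_top (ENNReal.ofReal_ne_top (r := B - A)) ?_
  refine iSup_le ?_
  rintro ⟨n, u, hu, hus⟩
  calc ∑ i ∈ Finset.range n, edist (f (u (i + 1))) (f (u i))
      ≤ ∑ i ∈ Finset.range n, ENNReal.ofReal (g (u (i + 1)) - g (u i)) := by
        refine Finset.sum_le_sum fun i _ => ?_
        rw [edist_dist, Real.dist_eq]
        exact ENNReal.ofReal_le_ofReal (hfg _ (hus i) _ (hus _) (hu i.le_succ))
    _ = ENNReal.ofReal (g (u n) - g (u 0)) := by
        rw [← ENNReal.ofReal_sum_of_nonneg, Finset.sum_range_sub (fun i => g (u i))]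
        exact fun i _ => (abs_nonneg _).trans (hfg _ (hus i) _ (hus _) (hu i.le_succ))
    _ ≤ ENNReal.ofReal (B - A) := by
        have h1 := hg _ (hus n)
        have h2 := hg _ (hus 0)
        exact ENNReal.ofReal_le_ofReal (by linarith [h1.2, h2.1])

theorem boundedVariationOn_Ioo_of_hausdorffMeasure_lt_top {a b : ℝ} {h : ℝ → ℝ}
    (hlsc : LowerSemicontinuousOn h (Icc a b)) (hfin : μH[1] (filmGraph a b h) < ⊤) :
    BoundedVariationOn h (Ioo a b) := by
  have hm : Measurable (fun p : EuclideanSpace ℝ (Fin 2) => p 0) := by fun_prop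
  set ν : Measure (EuclideanSpace ℝ (Fin 2)) := (μH[1]).restrict (filmGraph a b h)
  have : IsFiniteMeasure ν := ⟨by simpa [ν] using hfin⟩
  set ρ : Measure ℝ := ν.map (fun p => p 0)
  have hρ : ∀ c ∈ Ioo a b, ∀ d ∈ Ioo a b, c ≤ d → |h d - h c| ≤ ρ.real (Icc c d) := by
    intro c hc d hd hcd
    rw [measureReal_def, ← ENNReal.ofReal_le_iff_le_toReal (measure_ne_top _ _),
      Measure.map_apply hm measurableSet_Icc, Measure.restrict_apply (hm measurableSet_Icc),
      inter_comm]
    exact ofReal_abs_sub_le_hausdorffMeasure hlsc hc hd hcd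
  refine boundedVariationOn_of_abs_sub_le (A := 0) (B := 2 * ρ.real univ)
    (g := fun t => ρ.real (Iic t) + ρ.real (Iio t)) ?_ ?_
  · intro c hc d hd hcd
    rcases hcd.eq_or_lt with rfl | hlt
    · simp
    · have h1 : ρ.real (Iic d) = ρ.real (Iio c) + ρ.real (Icc c d) := by
        rw [← measureReal_union _ measurableSet_Icc, Iio_union_Icc_eq_Iic hcd]
        exact disjoint_left.2 fun x hx hx' => absurd hx (not_lt.2 hx'.1)
      have h2 : ρ.real (Iic c) ≤ ρ.real (Iio d) := measureReal_mono (Iic_subset_Iio.2 hlt)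
      linarith [hρ c hc d hd hcd]
  · intro x _
    have h1 : ρ.real (Iic x) ≤ ρ.real univ := measureReal_mono (subset_univ _)
    have h2 : ρ.real (Iio x) ≤ ρ.real univ := measureReal_mono (subset_univ _)
    exact ⟨by positivity, by linarith⟩

theorem BoundedVariationOn.Icc_of_Ioo {a b : ℝ} {f : ℝ → ℝ}
    (hf : BoundedVariationOn f (Ioo a b)) : BoundedVariationOn f (Icc a b) := by
  rcases le_or_gt b a with hba | hab
  · exact BoundedVariationOn.of_subsingleton (subsingleton_Icc_of_ge hba)
  obtain ⟨m, hm⟩ := exists_between hab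
  set V := variationOnFromTo f (Ioo a b) m
  set W := (eVariationOn f (Ioo a b)).toReal
  set M := |f a| + |f b| + |f m| + W
  have hW : 0 ≤ W := ENNReal.toReal_nonneg
  have hV : ∀ x ∈ Ioo a b, ∀ y ∈ Ioo a b, x ≤ y → |f y - f x| ≤ V y - V x :=
    fun x hx y hy hxy => variationOnFromTo.abs_sub_le_sub_of_le
      hf.locallyBoundedVariationOn hm hx hy hxy
  have hfM : ∀ x ∈ Icc a b, |f x| ≤ M := by
    intro x hx
    rcases eq_endpoints_or_mem_Ioo_of_mem_Icc hx with rfl | rfl | hx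
    · linarith [abs_nonneg (f b), abs_nonneg (f m)]
    · linarith [abs_nonneg (f a), abs_nonneg (f m)]
    · have h1 := hf.dist_le hx hm
      rw [Real.dist_eq] at h1
      linarith [abs_sub_abs_le_abs_sub (f x) (f m), abs_nonneg (f a), abs_nonneg (f b)]
  have hVM : ∀ x, |V x| ≤ M := fun x => by
    linarith [variationOnFromTo.abs_le_eVariationOn hf (a := m) (b := x),
      abs_nonneg (f a), abs_nonneg (f b), abs_nonneg (f m)]
  refine boundedVariationOn_of_abs_sub_le (A := -(3 * M)) (B := 3 * M)
    (g := fun x => if x ≤ a then -(3 * M) else if b ≤ x then 3 * M else V x) ?_ ?_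
  · intro x hx y hy hxy
    rcases hxy.eq_or_lt with rfl | hlt
    · simp
    have hya : ¬ y ≤ a := not_le.2 (hx.1.trans_lt hlt)
    have hxb : ¬ b ≤ x := not_le.2 (hlt.trans_le hy.2)
    have hd : |f y - f x| ≤ 2 * M := by
      linarith [abs_sub (f y) (f x), hfM x hx, hfM y hy]
    have h1 := abs_le.1 (hVM x)
    have h2 := abs_le.1 (hVM y)
    simp only [hya, hxb, if_false]
    split_ifs with hyb hxa hxa
    · linarith
    · linarith
    · linarith
    · exact hV x ⟨not_le.1 hxa, not_le.1 hxb⟩ y ⟨not_le.1 hya, not_le.1 hyb⟩ hxy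
  · intro x _
    have h1 := abs_le.1 (hVM x)
    split_ifs <;> constructor <;> linarith

/-- For a lower semicontinuous height function `h : [a,b] → [0,∞)`,
`h` has finite pointwise variation on `[a,b]` if and only if the one-dimensional
Hausdorff measure of its graph `Γ_h` is finite. -/
theorem finite_variation_iff_hausdorff_graph_finite
    (a b : ℝ) (hab : a < b) (h : ℝ → ℝ)
    (hlsc : LowerSemicontinuousOn h (Set.Icc a b))
    (hnn : ∀ x ∈ Set.Icc a b, 0 ≤ h x) :
    BoundedVariationOn h (Set.Icc a b) ↔ μH[1] (filmGraph a b h) < ⊤ := by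
  exact ⟨hausdorffMeasure_filmGraph_lt_top hab hlsc, fun hfin =>
    (boundedVariationOn_Ioo_of_hausdorffMeasure_lt_top hlsc hfin).Icc_of_Ioo⟩
end

section
/- Let a < b be real numbers and let h ∈ AP(a,b). Then the function h⁻ : (a,b) → [0,∞) defined by h⁻(x) := liminf_{z→x} h(z) is lower semicontinuous, and the interior of the closure of Ω_h equals {(x,y) ∈ ℝ² : a < x < b, y < h⁻(x)}. -/
open MeasureTheory Topology Filter Set

/-- `h⁻(x) = liminf_{z → x} h(z)`. -/
noncomputable def hMinus (h : ℝ → ℝ) (x : ℝ) : ℝ :=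
  Filter.liminf h (𝓝[≠] x)

theorem BoundedVariationOn.isBoundedUnder_le_nhdsNE {h : ℝ → ℝ} {a b x : ℝ}
    (hbv : BoundedVariationOn h (Icc a b)) (hx : x ∈ Ioo a b) :
    IsBoundedUnder (· ≤ ·) (𝓝[≠] x) h := by
  refine isBoundedUnder_of_eventually_le (a := h x + (eVariationOn h (Icc a b)).toReal) ?_
  filter_upwards [mem_nhdsWithin_of_mem_nhds (Ioo_mem_nhds hx.1 hx.2)] with z hz
  linarith [hbv.sub_le (Ioo_subset_Icc_self hz) (Ioo_subset_Icc_self hx)]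

theorem BoundedVariationOn.isBoundedUnder_ge_nhdsNE {h : ℝ → ℝ} {a b x : ℝ}
    (hbv : BoundedVariationOn h (Icc a b)) (hx : x ∈ Ioo a b) :
    IsBoundedUnder (· ≥ ·) (𝓝[≠] x) h := by
  refine isBoundedUnder_of_eventually_ge (a := h x - (eVariationOn h (Icc a b)).toReal) ?_
  filter_upwards [mem_nhdsWithin_of_mem_nhds (Ioo_mem_nhds hx.1 hx.2)] with z hz
  linarith [hbv.sub_le (Ioo_subset_Icc_self hx) (Ioo_subset_Icc_self hz)]

/-- A property that holds in a punctured neighbourhood of `x` holds in a punctured neighbourhood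
of every point near `x`. -/
theorem eventually_nhds_eventually_nhdsNE {p : ℝ → Prop} {x : ℝ} (hp : ∀ᶠ z in 𝓝[≠] x, p z) :
    ∀ᶠ z in 𝓝 x, ∀ᶠ w in 𝓝[≠] z, p w := by
  filter_upwards [eventually_eventually_nhds.2 (eventually_nhdsWithin_iff.1 hp)] with z hz
  by_cases hzx : z = x
  · rwa [hzx]
  · filter_upwards [nhdsWithin_le_nhds hz, nhdsWithin_le_nhds (isOpen_ne.mem_nhds hzx)]
      with w hw hwx using hw hwx

theorem eventually_eventually_lt_of_tendsto {h : ℝ → ℝ} {s : Set ℝ} (hs : IsOpen s)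
    {x l c : ℝ} (hl : Tendsto h (𝓝[s] x) (𝓝 l)) (hfreq : ∃ᶠ z in 𝓝[s] x, h z < c)
    {c' : ℝ} (hc : c < c') : ∀ᶠ x' in 𝓝[s] x, ∀ᶠ z in 𝓝 x', h z < c' := by
  have hlc : l ≤ c := by
    by_contra! hcl
    exact hfreq ((hl.eventually_const_lt hcl).mono fun z hz => not_lt.2 hz.le)
  filter_upwards [eventually_eventually_nhdsWithin.2 (hl.eventually_lt_const (hlc.trans_lt hc)),
    self_mem_nhdsWithin] with x' hx' hmem
  rwa [hs.nhdsWithin_eq hmem] at hx'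

/-- If `h⁻(x) < c`, then arbitrarily close to `x` there are open intervals on which `h < c`. -/
theorem BoundedVariationOn.frequently_eventually_lt_of_hMinus_lt {h : ℝ → ℝ} {a b x c : ℝ}
    (hbv : BoundedVariationOn h (Icc a b)) (hx : x ∈ Ioo a b) (hc : hMinus h x < c) :
    ∃ᶠ x' in 𝓝[≠] x, ∀ᶠ z in 𝓝 x', h z < c := by
  obtain ⟨d, hd, hdc⟩ := exists_between hc
  have hfreq := frequently_lt_of_liminf_lt
    (hbv.isBoundedUnder_le_nhdsNE hx).isCoboundedUnder_ge hd
  have hbv' := hbv.mono Ioo_subset_Icc_self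
  have hnear := isOpen_Ioo.mem_nhds hx
  obtain ⟨l, hl⟩ := hbv'.exists_tendsto_left x
  obtain ⟨r, hr⟩ := hbv'.exists_tendsto_right x
  rw [inter_comm, nhdsWithin_inter_of_mem' (nhdsWithin_le_nhds hnear)] at hl hr
  rw [← nhdsLT_sup_nhdsGT, frequently_sup] at hfreq ⊢
  exact hfreq.imp
    (fun hf => (eventually_eventually_lt_of_tendsto isOpen_Iio hl hf hdc).frequently)
    (fun hf => (eventually_eventually_lt_of_tendsto isOpen_Ioi hr hf hdc).frequently)

theorem BoundedVariationOn.lowerSemicontinuousOn_hMinus {h : ℝ → ℝ} {a b : ℝ}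
    (hbv : BoundedVariationOn h (Icc a b)) : LowerSemicontinuousOn (hMinus h) (Ioo a b) := by
  intro x hx y hy
  obtain ⟨c, hyc, hcx⟩ := exists_between hy
  have hev := eventually_lt_of_lt_liminf hcx (hbv.isBoundedUnder_ge_nhdsNE hx)
  filter_upwards [nhdsWithin_le_nhds (eventually_nhds_eventually_nhdsNE hev),
    self_mem_nhdsWithin] with z hz hzmem
  exact hyc.trans_le (le_liminf_of_le
    (hbv.isBoundedUnder_le_nhdsNE hzmem).isCoboundedUnder_ge (hz.mono fun _ => le_of_lt))

theorem toLp_coords (p : EuclideanSpace ℝ (Fin 2)) : !₂[p 0, p 1] = p := by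
  ext i
  fin_cases i <;> rfl

theorem mem_closure_filmSubgraph {a b c : ℝ} {h : ℝ → ℝ} {q : EuclideanSpace ℝ (Fin 2)}
    (hq : ∀ᶠ w in 𝓝[≠] q 0, w ∈ Ioo a b ∧ c < h w) (hqc : q 1 < c) :
    q ∈ closure (filmSubgraph a b h) := by
  have hcont : Continuous fun w : ℝ => !₂[w, q 1] := by fun_prop
  have ht : Tendsto (fun w : ℝ => !₂[w, q 1]) (𝓝[≠] q 0) (𝓝 q) := by
    simpa only [toLp_coords] using (hcont.tendsto (q 0)).mono_left nhdsWithin_le_nhds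
  refine mem_closure_of_tendsto ht (hq.mono fun w hw => ?_)
  exact ⟨hw.1.1, hw.1.2, hqc.trans hw.2⟩

theorem mem_Icc_of_mem_closure_filmSubgraph {a b : ℝ} {h : ℝ → ℝ}
    {q : EuclideanSpace ℝ (Fin 2)} (hq : q ∈ closure (filmSubgraph a b h)) :
    q 0 ∈ Icc a b := by
  have hcl : IsClosed {q : EuclideanSpace ℝ (Fin 2) | q 0 ∈ Icc a b} :=
    isClosed_Icc.preimage (by fun_prop)
  have hsub : filmSubgraph a b h ⊆ {q | q 0 ∈ Icc a b} := fun q hq => ⟨hq.1.le, hq.2.1.le⟩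
  exact closure_minimal hsub hcl hq

theorem notMem_closure_filmSubgraph {a b c : ℝ} {h : ℝ → ℝ} {q : EuclideanSpace ℝ (Fin 2)}
    (hq : ∀ᶠ z in 𝓝 (q 0), h z < c) (hqc : c < q 1) :
    q ∉ closure (filmSubgraph a b h) := by
  rw [mem_closure_iff_frequently, not_frequently]
  have h0 : Continuous fun p : EuclideanSpace ℝ (Fin 2) => p 0 := by fun_prop
  have h1 : Continuous fun p : EuclideanSpace ℝ (Fin 2) => p 1 := by fun_prop
  filter_upwards [h0.continuousAt.eventually hq, h1.continuousAt.eventually (lt_mem_nhds hqc)]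
    with p hp0 hp1 hp
  exact (hp0.trans hp1).not_gt hp.2.2

theorem mem_Ioo_of_mem_interior_closure_filmSubgraph {a b : ℝ} {h : ℝ → ℝ}
    {p : EuclideanSpace ℝ (Fin 2)} (hp : p ∈ interior (closure (filmSubgraph a b h))) :
    p 0 ∈ Ioo a b := by
  have hcont : Continuous fun x : ℝ => !₂[x, p 1] := by fun_prop
  have hev : ∀ᶠ x in 𝓝 (p 0), x ∈ Icc a b := by
    filter_upwards [hcont.continuousAt (isOpen_interior.mem_nhds (by rwa [toLp_coords]))]
      with x hx using mem_Icc_of_mem_closure_filmSubgraph (interior_subset hx)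
  rw [← interior_Icc]
  exact mem_interior_iff_mem_nhds.2 hev

theorem BoundedVariationOn.lt_hMinus_of_mem_interior_closure_filmSubgraph {h : ℝ → ℝ} {a b : ℝ}
    (hbv : BoundedVariationOn h (Icc a b)) {p : EuclideanSpace ℝ (Fin 2)}
    (hp : p ∈ interior (closure (filmSubgraph a b h))) : p 1 < hMinus h (p 0) := by
  by_contra! hle
  have hvert : Continuous fun y : ℝ => !₂[p 0, y] := by fun_prop
  have hev : ∀ᶠ y in 𝓝 (p 1), !₂[p 0, y] ∈ interior (closure (filmSubgraph a b h)) :=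
    hvert.continuousAt (isOpen_interior.mem_nhds (by rwa [toLp_coords]))
  obtain ⟨y, hy, hpy⟩ :=
    ((hev.filter_mono nhdsWithin_le_nhds).and (self_mem_nhdsWithin (s := Ioi (p 1)))).exists
  obtain ⟨c, hc, hcy⟩ := exists_between (hle.trans_lt hpy)
  have hhor : Continuous fun x : ℝ => !₂[x, y] := by fun_prop
  have hev' : ∀ᶠ x in 𝓝 (p 0), !₂[x, y] ∈ interior (closure (filmSubgraph a b h)) :=
    hhor.continuousAt (isOpen_interior.mem_nhds hy)
  obtain ⟨x, hx, hxU⟩ := ((hbv.frequently_eventually_lt_of_hMinus_lt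
    (mem_Ioo_of_mem_interior_closure_filmSubgraph hp) hc).and_eventually
      (hev'.filter_mono nhdsWithin_le_nhds)).exists
  exact notMem_closure_filmSubgraph (q := !₂[x, y]) hx hcy (interior_subset hxU)

theorem BoundedVariationOn.mem_interior_closure_filmSubgraph {h : ℝ → ℝ} {a b : ℝ}
    (hbv : BoundedVariationOn h (Icc a b)) {p : EuclideanSpace ℝ (Fin 2)}
    (hp : p 0 ∈ Ioo a b) (hlt : p 1 < hMinus h (p 0)) :
    p ∈ interior (closure (filmSubgraph a b h)) := by
  obtain ⟨c, hpc, hc⟩ := exists_between hlt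
  have hev : ∀ᶠ z in 𝓝[≠] p 0, z ∈ Ioo a b ∧ c < h z :=
    ((isOpen_Ioo.eventually_mem hp).filter_mono nhdsWithin_le_nhds).and
      (eventually_lt_of_lt_liminf hc (hbv.isBoundedUnder_ge_nhdsNE hp))
  have h0 : Continuous fun p : EuclideanSpace ℝ (Fin 2) => p 0 := by fun_prop
  have h1 : Continuous fun p : EuclideanSpace ℝ (Fin 2) => p 1 := by fun_prop
  rw [mem_interior_iff_mem_nhds]
  filter_upwards [h0.continuousAt.eventually (eventually_nhds_eventually_nhdsNE hev),
    h1.continuousAt.eventually (gt_mem_nhds hpc)] with q hq0 hq1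
  exact mem_closure_filmSubgraph hq0 hq1

/-- For `h ∈ AP(a,b)`, the function `h⁻(x) = liminf_{z→x} h(z)` is
lower semicontinuous on `(a,b)`, and the interior of the closure of `Ω_h` equals
`{(x,y) : a < x < b, y < h⁻(x)}`. -/
theorem hMinus_lowerSemicontinuous_and_interior_closure_subgraph
    (a b : ℝ) (hab : a < b) (h : ℝ → ℝ)
    (hlsc : LowerSemicontinuousOn h (Set.Icc a b))
    (hnn : ∀ x ∈ Set.Icc a b, 0 ≤ h x)
    (hbv : BoundedVariationOn h (Set.Icc a b)) :
    LowerSemicontinuousOn (hMinus h) (Set.Ioo a b) ∧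
    interior (closure (filmSubgraph a b h))
      = {p : EuclideanSpace ℝ (Fin 2) |
          a < p 0 ∧ p 0 < b ∧ p 1 < hMinus h (p 0)} := by
  refine ⟨hbv.lowerSemicontinuousOn_hMinus, Set.ext fun p => ⟨fun hp => ?_, fun hp => ?_⟩⟩
  · have hmem := mem_Ioo_of_mem_interior_closure_filmSubgraph hp
    exact ⟨hmem.1, hmem.2, hbv.lt_hMinus_of_mem_interior_closure_filmSubgraph hp⟩
  · exact hbv.mem_interior_closure_filmSubgraph ⟨hp.1, hp.2.1⟩ hp.2.2
end

section
/- Let a < b be real numbers and let h ∈ AP(a,b). Then both Γ_h and Γ̃_h are connected subsets of ℝ². -/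
open MeasureTheory Topology Filter Set

/-- `Γ̃_h = ∂(cl Ω_h) ∩ ((a,b) × ℝ)`. -/
def filmGraphTilde (a b : ℝ) (h : ℝ → ℝ) : Set (EuclideanSpace ℝ (Fin 2)) :=
  frontier (closure (filmSubgraph a b h)) ∩ filmStrip a b

/-- The vertical section map `y ↦ (x, y)` is continuous. -/
theorem continuous_vertical (x : ℝ) :
    Continuous fun y : ℝ ↦ (!₂[x, y] : EuclideanSpace ℝ (Fin 2)) := by
  refine (PiLp.continuous_toLp 2 _).comp (continuous_pi fun i ↦ ?_)
  fin_cases i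
  · exact continuous_const
  · exact continuous_id

theorem continuous_coord (i : Fin 2) :
    Continuous fun p : EuclideanSpace ℝ (Fin 2) ↦ p i := by
  fun_prop

theorem eq_vertical (p : EuclideanSpace ℝ (Fin 2)) : p = !₂[p 0, p 1] := by
  ext i
  fin_cases i <;> rfl

/-- A set is vertically down-closed if it contains every point below one of its points. -/
def VerticallyDownClosed (A : Set (EuclideanSpace ℝ (Fin 2))) : Prop :=
  ∀ p ∈ A, ∀ t : ℝ, 0 ≤ t → p + !₂[0, -t] ∈ A

theorem VerticallyDownClosed.closure {A : Set (EuclideanSpace ℝ (Fin 2))}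
    (hA : VerticallyDownClosed A) : VerticallyDownClosed (closure A) := fun p hp t ht ↦
  map_mem_closure (f := fun q ↦ q + !₂[0, -t]) (by fun_prop) hp fun q hq ↦ hA q hq t ht

theorem VerticallyDownClosed.interior {A : Set (EuclideanSpace ℝ (Fin 2))}
    (hA : VerticallyDownClosed A) : VerticallyDownClosed (interior A) := by
  intro p hp t ht
  have hsub : A ⊆ Homeomorph.addRight (!₂[0, -t] : EuclideanSpace ℝ (Fin 2)) ⁻¹' A :=
    fun q hq ↦ hA q hq t ht
  have := interior_mono hsub hp
  rwa [← Homeomorph.preimage_interior] at this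

theorem VerticallyDownClosed.mem_of_le {A : Set (EuclideanSpace ℝ (Fin 2))}
    (hA : VerticallyDownClosed A) {x y z : ℝ} (hz : !₂[x, z] ∈ A) (hyz : y ≤ z) :
    !₂[x, y] ∈ A := by
  have := hA _ hz (z - y) (by linarith)
  convert this using 1
  ext i
  fin_cases i <;> simp

theorem isOpen_filmStrip (a b : ℝ) : IsOpen (filmStrip a b) :=
  (isOpen_lt continuous_const (continuous_coord 0)).inter
    (isOpen_lt (continuous_coord 0) continuous_const)

theorem height_le_of_mem_closure {A : Set (EuclideanSpace ℝ (Fin 2))} {M : ℝ}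
    (hup : ∀ p ∈ A, p 1 ≤ M) : ∀ p ∈ closure A, p 1 ≤ M := fun _ hp ↦
  closure_minimal (t := {p : EuclideanSpace ℝ (Fin 2) | p 1 ≤ M}) hup
    (isClosed_le (continuous_coord 1) continuous_const) hp

/-- The part over `(a, b)` of the frontier of a vertically down-closed set with heights bounded
from above and from below over `(a, b)` is connected. -/
theorem VerticallyDownClosed.isConnected_frontier_inter_filmStrip
    {a b m M : ℝ} (hab : a < b) {A : Set (EuclideanSpace ℝ (Fin 2))}
    (hA : VerticallyDownClosed A) (hlow : ∀ p ∈ filmStrip a b, p 1 < m → p ∈ A)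
    (hup : ∀ p ∈ A, p 1 ≤ M) :
    IsConnected (frontier A ∩ filmStrip a b) := by
  have hclup : ∀ p ∈ _root_.closure A, p 1 ≤ M := height_le_of_mem_closure hup
  have hfrlow : ∀ p ∈ frontier A ∩ filmStrip a b, m ≤ p 1 := by
    rintro p ⟨hp, hs⟩
    by_contra! hlt
    refine hp.2 (interior_maximal
      (show filmStrip a b ∩ {p | p 1 < m} ⊆ A from fun q hq ↦ hlow q hq.1 hq.2) ?_ ⟨hs, hlt⟩)
    exact (isOpen_filmStrip a b).inter (isOpen_lt (continuous_coord 1) continuous_const)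
  have hfiber : ∀ x ∈ Ioo a b, IsConnected {y : ℝ | !₂[x, y] ∈ frontier A} := by
    intro x hx
    refine ⟨?_, OrdConnected.isPreconnected ⟨?_⟩⟩
    · have hcl : IsClosed {y : ℝ | !₂[x, y] ∈ _root_.closure A} :=
        isClosed_closure.preimage (continuous_vertical x)
      have hne : {y : ℝ | !₂[x, y] ∈ _root_.closure A}.Nonempty :=
        ⟨m - 1, subset_closure (hlow _ hx (by simp))⟩
      have hbdd : BddAbove {y : ℝ | !₂[x, y] ∈ _root_.closure A} :=
        ⟨M, fun y hy ↦ by simpa using hclup _ hy⟩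
      refine ⟨_, hcl.csSup_mem hne hbdd, fun hint ↦ ?_⟩
      have hopen : IsOpen {y : ℝ | !₂[x, y] ∈ _root_.interior A} :=
        isOpen_interior.preimage (continuous_vertical x)
      obtain ⟨z, hz, hzA⟩ := (mem_nhdsGT_iff_exists_Ioo_subset.1
        (mem_nhdsWithin_of_mem_nhds (hopen.mem_nhds hint)))
      obtain ⟨w, hw⟩ := exists_between (show _ < z from hz)
      exact hw.1.not_ge (le_csSup hbdd (subset_closure (interior_subset (hzA hw))))
    · intro y hy z hz w hw
      exact ⟨hA.closure.mem_of_le hz.1 hw.2, fun hi ↦ hy.2 (hA.interior.mem_of_le hi hw.1)⟩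
  let π : ↥(frontier A ∩ filmStrip a b) → Ioo a b := fun p ↦ ⟨p.1 0, p.2.2⟩
  have hπ : Continuous π :=
    ((continuous_coord 0).comp continuous_subtype_val).subtype_mk _
  have hconn : ∀ x : Ioo a b, IsConnected (π ⁻¹' {x}) := by
    intro x
    have himage : Subtype.val '' (π ⁻¹' {x}) =
        (fun y : ℝ ↦ (!₂[x.1, y] : EuclideanSpace ℝ (Fin 2))) ''
          {y : ℝ | !₂[x.1, y] ∈ frontier A} := by
      ext p
      constructor
      · rintro ⟨q, rfl, rfl⟩
        refine ⟨q.1 1, ?_, (eq_vertical q.1).symm⟩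
        change !₂[q.1 0, q.1 1] ∈ frontier A
        rw [← eq_vertical]
        exact q.2.1
      · rintro ⟨y, hy, rfl⟩
        exact ⟨⟨_, hy, x.2⟩, rfl, rfl⟩
    have hc := (hfiber x x.2).image _ (continuous_vertical x).continuousOn
    rw [← himage] at hc
    exact ⟨hc.1.of_image, IsInducing.subtypeVal.isPreconnected_image.1 hc.2⟩
  have hclosed : ∀ T : Set (Ioo a b), IsClosed (π ⁻¹' T) ↔ IsClosed T := by
    refine fun T ↦ ⟨fun hT ↦ IsSeqClosed.isClosed ?_, fun hT ↦ hT.preimage hπ⟩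
    intro u x hu hux
    choose y hy using fun n ↦ (hconn (u n)).1
    have hmem : ∀ n, (y n).1 1 ∈ Icc m M := fun n ↦
      ⟨hfrlow _ (y n).2, hclup _ (y n).2.1.1⟩
    obtain ⟨z, -, φ, hφ, hz⟩ := isCompact_Icc.tendsto_subseq hmem
    have hlim : Tendsto (fun n ↦ (y (φ n)).1) atTop (𝓝 !₂[x.1, z]) := by
      have : Tendsto (fun n ↦ ![(y (φ n)).1 0, (y (φ n)).1 1]) atTop (𝓝 ![x.1, z]) := by
        refine tendsto_pi_nhds.2 fun i ↦ ?_
        fin_cases i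
        · have := (continuous_subtype_val.tendsto x).comp (hux.comp hφ.tendsto_atTop)
          refine this.congr fun n ↦ ?_
          exact (congrArg Subtype.val (hy (φ n))).symm
        · exact hz
      refine (((PiLp.continuous_toLp 2 _).tendsto _).comp this).congr fun n ↦ ?_
      exact (eq_vertical _).symm
    have hfr : !₂[x.1, z] ∈ frontier A :=
      isClosed_frontier.mem_of_tendsto hlim (.of_forall fun n ↦ (y (φ n)).2.1)
    have hlim' : Tendsto (fun n ↦ y (φ n)) atTop
        (𝓝 (⟨!₂[x.1, z], hfr, x.2⟩ : ↥(frontier A ∩ filmStrip a b))) :=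
      tendsto_subtype_rng.2 hlim
    exact hT.mem_of_tendsto hlim' (.of_forall fun n ↦ by
      change π (y (φ n)) ∈ T
      rw [show π (y (φ n)) = u (φ n) from hy (φ n)]
      exact hu _)
  have : ConnectedSpace (Ioo a b) := Subtype.connectedSpace (isConnected_Ioo hab)
  have huniv := IsCoinducing.isConnected_preimage_of_isClosed
    hconn (isCoinducing_iff_isClosed.2 hclosed) isClosed_univ isConnected_univ
  simpa using huniv.image _ continuous_subtype_val.continuousOn

theorem verticallyDownClosed_filmSubgraph (a b : ℝ) (h : ℝ → ℝ) :
    VerticallyDownClosed (filmSubgraph a b h) := by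
  rintro p ⟨h1, h2, h3⟩ t ht
  refine ⟨by simpa using h1, by simpa using h2, ?_⟩
  simp only [PiLp.add_apply, Matrix.cons_val_zero, Matrix.cons_val_one, add_zero]
  linarith

/-- For `h ∈ AP(a,b)`, both `Γ_h` and `Γ̃_h` are connected. -/
theorem filmGraph_connected
    (a b : ℝ) (hab : a < b) (h : ℝ → ℝ)
    (hlsc : LowerSemicontinuousOn h (Set.Icc a b))
    (hnn : ∀ x ∈ Set.Icc a b, 0 ≤ h x)
    (hbv : BoundedVariationOn h (Set.Icc a b)) :
    IsConnected (filmGraph a b h) ∧ IsConnected (filmGraphTilde a b h) := by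
  have hup : ∀ p ∈ filmSubgraph a b h, p 1 ≤ h a + (eVariationOn h (Icc a b)).toReal := by
    rintro p ⟨h1, h2, h3⟩
    have := hbv.sub_le ⟨h1.le, h2.le⟩ (left_mem_Icc.2 hab.le)
    linarith
  have hlow : ∀ p ∈ filmStrip a b, p 1 < 0 → p ∈ filmSubgraph a b h := fun p hp hp0 ↦
    ⟨hp.1, hp.2, hp0.trans_le (hnn _ ⟨hp.1.le, hp.2.le⟩)⟩
  have hdown := verticallyDownClosed_filmSubgraph a b h
  refine ⟨hdown.isConnected_frontier_inter_filmStrip hab hlow hup,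
    hdown.closure.isConnected_frontier_inter_filmStrip hab
      (fun p hp hp0 ↦ subset_closure (hlow p hp hp0))
      (height_le_of_mem_closure hup)⟩
end

section
/- Let β ∈ (0,1), set t* := √(1−β²)/β, and let g < 0 be a real number. If −β(1/t* + 1/g) + 1/(β t*) + √(1+g²)/g ≥ 0, then g = −t*. -/
/-- In the dewetting regime `β ∈ (0,1)` with
`t* = √(1-β²)/β`, the limiting first-variation inequality at an island border
forces the blown-up left slope `g < 0` to equal `-t*`, i.e. the contact angle
equals the Young–Dupré angle `θ* = arccos β`. -/
theorem island_border_slope_eq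
    (β : ℝ) (hβ : β ∈ Set.Ioo (0:ℝ) 1)
    (tstar : ℝ) (htstar : tstar = Real.sqrt (1 - β^2) / β)
    (g : ℝ) (hg : g < 0)
    (hineq : -β * (1/tstar + 1/g) + 1/(β * tstar) + Real.sqrt (1 + g^2) / g ≥ 0) :
    g = -tstar := by
  obtain ⟨hβ0, hβ1⟩ := hβ
  have hpos : 0 < 1 - β ^ 2 := by nlinarith
  set s := Real.sqrt (1 - β ^ 2)
  have hs0 : 0 < s := Real.sqrt_pos.mpr hpos
  have hs2 : s ^ 2 = 1 - β ^ 2 := Real.sq_sqrt hpos.le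
  set S := Real.sqrt (1 + g ^ 2)
  have hS0 : 0 ≤ S := Real.sqrt_nonneg _
  have hS2 : S ^ 2 = 1 + g ^ 2 := Real.sq_sqrt (by positivity)
  have hsum : -β * (1 / tstar + 1 / g) + 1 / (β * tstar) + S / g = (s * g - β + S) / g := by
    have hg0 : g ≠ 0 := hg.ne
    rw [htstar]
    field_simp
    linear_combination -g * hs2
  rw [hsum] at hineq
  have hle : s * g - β + S ≤ 0 := by
    by_contra! h
    exact absurd hineq (not_le.mpr (div_neg_of_pos_of_neg h hg))
  have hsq : S ^ 2 ≤ (β - s * g) ^ 2 := pow_le_pow_left₀ hS0 (by linarith) 2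
  have hzero : (β * g + s) ^ 2 = 0 :=
    le_antisymm (by linear_combination hsq - hS2 + (g ^ 2 + 1) * hs2) (sq_nonneg _)
  have hlin : β * g + s = 0 := by simpa using hzero
  rw [htstar]
  field_simp
  linarith
end
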